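/- Let x_0 ∈ ℕ^d and let Γ′ be a subsemigroup of (ℕ^d, +) freely generated by a^{(1)},…,a^{(r)} (i.e., every element of Γ′ is uniquely of the form k_1 a^{(1)} + ⋯ + k_r a^{(r)} with k_i ∈ ℕ). Then, in ℤ[[t,q]], Σ_{x ∈ Γ′·x_0} t^{n(x)} q^{W(x)} = t^{n(x_0)} q^{W(x_0)} ∏_{i=1}^{r} (1 − Cont(a^{(i)}))^{−1}, where Γ′·x_0 = {g^a(x_0) : a ∈ Γ′} and for a = (a_1,…,a_d) ∈ ℕ^d, Cont(a) := t^{a_1+⋯+a_d} q^{0·a_1 + 1·a_2 + ⋯ + (d−1)·a_d}. -/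

import Mathlib

namespace Spiral

/-- The size `n(x) = n₁ + ⋯ + n_d` of a configuration `x ∈ ℕ^d`. -/
def size {d : ℕ} (x : Fin d → ℕ) : ℕ := ∑ i, x i

/-- The weight `W(x) = Σ_{i<j} (max(0, x_j − x_i) + max(0, x_i − x_j − 1))`
(truncated ℕ-subtraction realizes the `max(0,·)`). -/
def weight {d : ℕ} (x : Fin d → ℕ) : ℕ :=
  ∑ i : Fin d, ∑ j : Fin d, if i < j then (x j - x i) + (x i - x j - 1) else 0

/-- The configuration `x` as a set of points of `[d] × ℕ`: the point `(i, n)` (seat `i`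
0-indexed, level `n`) is encoded as the natural number `n*d + i`. The usual order on the
encodings is exactly the height order `≺` (height `h(i,n) = n + i/d`), and the spiral
shift `δ + s/d` is encoded as `+ s`. -/
def pts (d : ℕ) (x : Fin d → ℕ) : Finset ℕ :=
  Finset.image (fun i : Fin d => x i * d + i.val) Finset.univ

/-- The points of `x` listed in increasing height order: `δ¹(x), …, δ^d(x)`. -/
def sortedPts (d : ℕ) (x : Fin d → ℕ) : List ℕ :=
  (pts d x).sort (· ≤ ·)

/-- The lowest point strictly above `p` (along the spiral) whose seat lies in `S`. -/
noncomputable def nextPt (d : ℕ) (S : Finset ℕ) (p : ℕ) : ℕ :=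
  sInf {q : ℕ | p < q ∧ q % d ∈ S}

/-- The spiral shifting operator `g_j` (for `1 ≤ j ≤ d`): it fixes the lowest `j - 1`
points `δ¹(x), …, δ^{j-1}(x)` and moves each remaining point `δ^k(x)` (`k ≥ j`) to
`δ^k(x) + s_k/d`, where `s_k` is the minimal positive integer such that the seat of
`δ^k(x) + s_k/d` lies in `{i(δ^j(x)), …, i(δ^d(x))}`. The resulting configuration is read
off from the new point set (which has exactly one point per seat). -/
noncomputable def gOp (d : ℕ) (j : ℕ) (x : Fin d → ℕ) : Fin d → ℕ := fun i =>
  let L := sortedPts d x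
  let low := L.take (j - 1)
  let high := L.drop (j - 1)
  let S : Finset ℕ := high.toFinset.image (· % d)
  let Q : Finset ℕ := low.toFinset ∪ (high.map (nextPt d S)).toFinset
  ∑ q ∈ Q.filter (fun q => q % d = i.val), q / d

/-- `g^a := g₁^{a₁} ∘ ⋯ ∘ g_d^{a_d}` (here `a i` is the exponent of `g_{i+1}`). -/
noncomputable def gIter (d : ℕ) (a : Fin d → ℕ) (x : Fin d → ℕ) : Fin d → ℕ :=
  (List.finRange d).foldr (fun j y => (gOp d (j.val + 1))^[a j] y) x

end Spiral

namespace Spiral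

/-- `Cont(a) = t^{a₁+⋯+a_d} q^{0·a₁ + 1·a₂ + ⋯ + (d−1)·a_d} ∈ ℤ[[t,q]]` for `a ∈ ℕ^d`
(with `t = X 0`, `q = X 1`; here `a i` is the exponent of `g_{i+1}`). -/
noncomputable def contGamma (d : ℕ) (a : Fin d → ℕ) : MvPowerSeries (Fin 2) ℤ :=
  MvPowerSeries.X 0 ^ (∑ i, a i) * MvPowerSeries.X 1 ^ (∑ i : Fin d, i.val * a i)

/-- The generating series `Σ_{x ∈ S} t^{n(x)} q^{W(x)} ∈ ℤ[[t,q]]` of a set `S ⊆ ℕ^d` of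
configurations, defined coefficientwise (each coefficient is a finite count, since only
finitely many `x ∈ ℕ^d` have a given size). -/
noncomputable def orbitSeries (d : ℕ) (S : Set (Fin d → ℕ)) : MvPowerSeries (Fin 2) ℤ :=
  fun e => (Nat.card {x : Fin d → ℕ // x ∈ S ∧ size x = e 0 ∧ weight x = e 1} : ℤ)

end Spiral


namespace Spiral

section gf
variable {r : ℕ}

lemma gf_finite (m : Fin 2 →₀ ℕ) (u : Fin r → (Fin 2 →₀ ℕ)) (hu : ∀ i, u i 0 ≠ 0)
    (e : Fin 2 →₀ ℕ) : Finite {k : Fin r → ℕ // m + ∑ i, k i • u i = e} := by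
  have : Set.Finite {k : Fin r → ℕ | m + ∑ i, k i • u i = e} := by
    apply (Set.finite_Iic (fun _ : Fin r => e 0)).subset
    intro k hk i
    have h := congrArg (fun f => f 0) (show m + ∑ i, k i • u i = e from hk)
    simp only [Finsupp.add_apply, Finsupp.finsetSum_apply, Finsupp.smul_apply, smul_eq_mul] at h
    have h1 : k i * u i 0 ≤ ∑ i, k i * u i 0 :=
      Finset.single_le_sum (f := fun i => k i * u i 0) (fun _ _ => Nat.zero_le _) (Finset.mem_univ i)
    have h2 : k i ≤ k i * u i 0 := Nat.le_mul_of_pos_right _ (Nat.pos_of_ne_zero (hu i))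
    show k i ≤ e 0
    omega
  exact this.to_subtype

noncomputable def gf (m : Fin 2 →₀ ℕ) (u : Fin r → (Fin 2 →₀ ℕ)) : MvPowerSeries (Fin 2) ℤ :=
  fun e => (Nat.card {k : Fin r → ℕ // m + ∑ i, k i • u i = e} : ℤ)

lemma gf_step (m : Fin 2 →₀ ℕ) (u : Fin (r+1) → (Fin 2 →₀ ℕ)) (hu : ∀ i, u i 0 ≠ 0) :
    (1 - MvPowerSeries.monomial (u 0) 1) * gf m u = gf m (fun i => u i.succ) := by
  classical
  ext e
  rw [sub_mul, one_mul, map_sub, MvPowerSeries.coeff_monomial_mul]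
  have c1 : ∀ {n : ℕ} (v : Fin n → (Fin 2 →₀ ℕ)) e, MvPowerSeries.coeff e (gf m v) =
     (Nat.card {k : Fin n → ℕ // m + ∑ i, k i • v i = e} : ℤ) := fun _ _ => rfl
  rw [c1, c1, c1]
  have := gf_finite m u hu e
  have e1 := Nat.card_congr (Equiv.sumCompl (fun k : {k : Fin (r+1) → ℕ // m + ∑ i, k i • u i = e} => k.1 0 = 0))
  rw [Nat.card_sum] at e1
  have e2 : Nat.card {k : {k : Fin (r+1) → ℕ // m + ∑ i, k i • u i = e} // k.1 0 = 0} =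
      Nat.card {k : Fin r → ℕ // m + ∑ i, k i • u i.succ = e} := by
    refine Nat.card_congr ⟨fun k => ⟨fun i => k.1.1 i.succ, ?_⟩, fun k => ⟨⟨Fin.cons 0 k.1, ?_⟩, ?_⟩, ?_, ?_⟩
    · have := k.1.2
      rw [Fin.sum_univ_succ, k.2] at this
      simpa using this
    · rw [Fin.sum_univ_succ]; simpa using k.2
    · simp
    · rintro ⟨⟨k, hk⟩, h0⟩
      ext i
      refine Fin.cases ?_ ?_ i
      · simpa using h0.symm
      · intro i; simp
    · rintro ⟨k, hk⟩
      simp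
  have e3 : (Nat.card {k : {k : Fin (r+1) → ℕ // m + ∑ i, k i • u i = e} // ¬ k.1 0 = 0} : ℤ) =
      if u 0 ≤ e then 1 * (Nat.card {k : Fin (r+1) → ℕ // m + ∑ i, k i • u i = e - u 0} : ℤ) else 0 := by
    split_ifs with h
    · rw [one_mul]
      congr 1
      refine Nat.card_congr ⟨fun k => ⟨Fin.cons (k.1.1 0 - 1) (fun i => k.1.1 i.succ), ?_⟩,
        fun k => ⟨⟨Fin.cons (k.1 0 + 1) (fun i => k.1 i.succ), ?_⟩, ?_⟩, ?_, ?_⟩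
      · rcases k with ⟨⟨k, hk⟩, h0⟩
        obtain ⟨n, hn⟩ := Nat.exists_eq_succ_of_ne_zero h0
        simp only at hn
        rw [Fin.sum_univ_succ, hn] at hk
        rw [Fin.sum_univ_succ]
        simp only [hn, Fin.cons_zero, Fin.cons_succ, Nat.succ_sub_one]
        rw [← hk, Nat.succ_eq_add_one, add_smul, one_smul]
        rw [eq_tsub_iff_add_eq_of_le]
        · abel
        · rw [hk.symm, Nat.succ_eq_add_one, add_smul, one_smul] at h
          exact h
      · have := k.2
        rw [eq_tsub_iff_add_eq_of_le h, Fin.sum_univ_succ] at this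
        rw [Fin.sum_univ_succ]
        simp only [Fin.cons_zero, Fin.cons_succ]
        refine Eq.trans ?_ this
        rw [add_smul, one_smul]
        abel
      · simp
      · rintro ⟨⟨k, hk⟩, h0⟩
        ext i
        refine Fin.cases ?_ ?_ i
        · have : k 0 ≠ 0 := h0
          simp
          omega
        · intro i; simp
      · rintro ⟨k, hk⟩
        ext i
        refine Fin.cases ?_ ?_ i
        · simp
        · intro i; simp
    · rw [Nat.cast_eq_zero, Nat.card_eq_zero]
      left
      refine ⟨?_⟩
      rintro ⟨⟨k, hk⟩, h0⟩
      obtain ⟨n, hn⟩ := Nat.exists_eq_succ_of_ne_zero h0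
      simp only at hn
      rw [Fin.sum_univ_succ, hn, Nat.succ_eq_add_one, add_smul, one_smul] at hk
      apply h
      rw [← hk]
      intro s
      simp only [Finsupp.add_apply]
      omega
  rw [← e3, ← e2, ← e1]
  push_cast
  ring

lemma gf_prod (m : Fin 2 →₀ ℕ) (u : Fin r → (Fin 2 →₀ ℕ)) (hu : ∀ i, u i 0 ≠ 0) :
    (∏ i, (1 - MvPowerSeries.monomial (u i) 1)) * gf m u = MvPowerSeries.monomial m 1 := by
  classical
  induction r with
  | zero =>
    ext e
    simp only [Finset.univ_eq_empty, Finset.prod_empty, one_mul]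
    rw [MvPowerSeries.coeff_monomial]
    change (Nat.card {k : Fin 0 → ℕ // m + ∑ i, k i • u i = e} : ℤ) = _
    by_cases h : e = m
    · subst h
      simp
    · simp [h, Ne.symm h]
  | succ r ih =>
    rw [Fin.prod_univ_succ, mul_assoc, mul_left_comm, gf_step m u hu]
    exact ih _ (fun i => hu _)

end gf
end Spiral

namespace Spiral

section nxt
variable {d : ℕ} {S : Finset ℕ}

lemma next_spec (hd : 1 ≤ d) (hS : S.Nonempty) (hlt : ∀ s ∈ S, s < d) (p : ℕ) :
    p < nextPt d S p ∧ nextPt d S p % d ∈ S := by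
  have : {q : ℕ | p < q ∧ q % d ∈ S}.Nonempty := by
    obtain ⟨s, hs⟩ := hS
    refine ⟨s + d * (p + 1), ?_, ?_⟩
    · nlinarith
    · rw [Nat.add_mul_mod_self_left, Nat.mod_eq_of_lt (hlt s hs)]; exact hs
  exact Nat.sInf_mem this

lemma next_le {p q : ℕ} (h : p < q) (hq : q % d ∈ S) : nextPt d S p ≤ q :=
  Nat.sInf_le ⟨h, hq⟩

lemma next_mono (hd : 1 ≤ d) (hS : S.Nonempty) (hlt : ∀ s ∈ S, s < d) {p q : ℕ}
    (h : p < q) (hq : q % d ∈ S) : nextPt d S p < nextPt d S q :=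
  (next_le h hq).trans_lt (next_spec hd hS hlt q).1

lemma next_inj (hd : 1 ≤ d) (hS : S.Nonempty) (hlt : ∀ s ∈ S, s < d) {p q : ℕ}
    (hp : p % d ∈ S) (hq : q % d ∈ S) (h : nextPt d S p = nextPt d S q) : p = q := by
  rcases lt_trichotomy p q with h1 | h1 | h1
  · have := next_mono hd hS hlt h1 hq; omega
  · exact h1
  · have := next_mono hd hS hlt h1 hp; omega

lemma next_add (hd : 1 ≤ d) (hS : S.Nonempty) (hlt : ∀ s ∈ S, s < d) (p k : ℕ) :
    nextPt d S (p + d * k) = nextPt d S p + d * k := by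
  obtain ⟨h1, h2⟩ := next_spec hd hS hlt p
  obtain ⟨h3, h4⟩ := next_spec hd hS hlt (p + d * k)
  apply le_antisymm
  · apply next_le (by omega)
    rwa [Nat.add_mul_mod_self_left]
  · have : nextPt d S p ≤ nextPt d S (p + d * k) - d * k := by
      apply next_le (by omega)
      rwa [Nat.sub_mul_mod (by omega)]
    omega

lemma next_mod_inj (hd : 1 ≤ d) (hS : S.Nonempty) (hlt : ∀ s ∈ S, s < d) {p q : ℕ}
    (hp : p % d ∈ S) (hq : q % d ∈ S) (h : nextPt d S p % d = nextPt d S q % d) :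
    p % d = q % d := by
  wlog hle : nextPt d S p ≤ nextPt d S q generalizing p q
  · exact (this hq hp h.symm (by omega)).symm
  obtain ⟨k, hk⟩ := (Nat.modEq_iff_dvd' hle).1 h
  have e : nextPt d S q = nextPt d S (p + d * k) := by
    rw [next_add hd hS hlt]; omega
  have := next_inj hd hS hlt hq (by rwa [Nat.add_mul_mod_self_left]) e
  rw [this, Nat.add_mul_mod_self_left]

lemma next_div (hd : 1 ≤ d) (hS : S.Nonempty) (hlt : ∀ s ∈ S, s < d) {p q : ℕ}
    (hp : p % d ∈ S) (hq : q % d ∈ S) :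
    (nextPt d S q - nextPt d S p) / d = (q - p) / d := by
  rcases le_or_gt p q with h | h
  · have hm : nextPt d S p ≤ nextPt d S q := by
      rcases h.eq_or_lt with h | h
      · rw [h]
      · exact (next_mono hd hS hlt h hq).le
    set k := (q - p) / d with hk
    have a1 : d * k ≤ q - p := Nat.mul_div_le _ _
    have a2 : q - p < d * (k + 1) := Nat.lt_mul_div_succ _ hd
    have b1 : nextPt d S p + d * k ≤ nextPt d S q := by
      rw [← next_add hd hS hlt]
      rcases (show p + d * k ≤ q by omega).eq_or_lt with h | h
      · rw [h]
      · exact (next_mono hd hS hlt h hq).le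
    have b2 : nextPt d S q < nextPt d S p + d * (k + 1) := by
      rw [← next_add hd hS hlt]
      exact next_mono hd hS hlt (by omega) (by rwa [Nat.add_mul_mod_self_left])
    rw [Nat.div_eq_iff (by omega)]
    constructor
    · rw [mul_comm]; omega
    · rw [mul_comm]; rw [mul_add] at b2; omega
  · have := next_mono hd hS hlt h hp
    rw [Nat.sub_eq_zero_of_le this.le, Nat.sub_eq_zero_of_le h.le]

lemma gap_sum (hd : 1 ≤ d) (hS : S.Nonempty) (hlt : ∀ s ∈ S, s < d) :
    ∑ s ∈ S, nextPt d S s = ∑ s ∈ S, s + d := by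
  have hmod : ∀ s ∈ S, s % d ∈ S := fun s hs => by rwa [Nat.mod_eq_of_lt (hlt s hs)]
  set μ := S.min' hS with hμ
  have hμS : μ ∈ S := S.min'_mem hS
  have hinj : Set.InjOn (nextPt d S) S := fun p hp q hq h =>
    next_inj hd hS hlt (hmod p hp) (hmod q hq) h
  have hnot : μ + d ∉ S.erase μ := fun h => by
    have := hlt _ (Finset.mem_of_mem_erase h); omega
  have himg : S.image (nextPt d S) = insert (μ + d) (S.erase μ) := by
    apply Finset.eq_of_subset_of_card_le
    · intro y hy
      obtain ⟨s, hs, rfl⟩ := Finset.mem_image.1 hy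
      obtain ⟨h1, h2⟩ := next_spec hd hS hlt s
      have hμs : μ ≤ s := S.min'_le s hs
      rw [Finset.mem_insert, Finset.mem_erase]
      by_cases h : nextPt d S s < d
      · right
        rw [Nat.mod_eq_of_lt h] at h2
        exact ⟨by omega, h2⟩
      · left
        have h3 : nextPt d S s ≤ μ + d := next_le (by have := hlt s hs; omega)
          (by rw [Nat.add_mod_right]; exact hmod _ hμS)
        have := hlt _ hμS
        have h4 : nextPt d S s % d = nextPt d S s - d := by
          rw [Nat.mod_eq_sub_mod (by omega), Nat.mod_eq_of_lt (by omega)]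
        have := S.min'_le _ h2
        omega
    · rw [Finset.card_image_of_injOn hinj, Finset.card_insert_of_notMem hnot,
        Finset.card_erase_of_mem hμS]
      have := Finset.card_pos.2 hS
      omega
  rw [← Finset.sum_image (f := fun y => y) hinj, himg, Finset.sum_insert hnot,
    ← Finset.add_sum_erase S (fun y => y) hμS]
  ring

lemma shift_sum (hd : 1 ≤ d) {H : Finset ℕ} (hH : H.Nonempty)
    (hinj : Set.InjOn (· % d) (H : Set ℕ)) (hS : S = H.image (· % d)) (c : ℕ)
    (hc : ∀ q ∈ H, c ≤ q) :
    ∑ q ∈ H, (nextPt d S q - c) / d = ∑ q ∈ H, (q - c) / d + 1 := by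
  have hSn : S.Nonempty := by rw [hS]; exact hH.image _
  have hmem : ∀ q ∈ H, q % d ∈ S := fun q hq => hS ▸ Finset.mem_image_of_mem _ hq
  have hlt : ∀ s ∈ S, s < d := by
    intro s hs
    rw [hS] at hs
    obtain ⟨q, _, rfl⟩ := Finset.mem_image.1 hs
    exact Nat.mod_lt _ hd
  -- the total shift is `d`
  have htot : ∑ q ∈ H, nextPt d S q = ∑ q ∈ H, q + d := by
    have e1 : ∑ q ∈ H, nextPt d S (q % d) = ∑ q ∈ H, (q % d) + d := by
      have := gap_sum hd hSn hlt
      conv at this => rw [hS]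
      rw [Finset.sum_image hinj, Finset.sum_image hinj] at this
      rw [hS]; exact this
    have e2 : ∀ q ∈ H, nextPt d S q = nextPt d S (q % d) + d * (q / d) := by
      intro q _
      rw [← next_add hd hSn hlt, Nat.mod_add_div]
    have e3 : ∑ q ∈ H, q = ∑ q ∈ H, (q % d + d * (q / d)) :=
      Finset.sum_congr rfl (fun q _ => (Nat.mod_add_div q d).symm)
    rw [Finset.sum_congr rfl e2, e3, Finset.sum_add_distrib, Finset.sum_add_distrib, e1]
    ring
  have htot' : ∑ q ∈ H, (nextPt d S q - c) = ∑ q ∈ H, (q - c) + d := by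
    have e1 : ∑ q ∈ H, (nextPt d S q - c) + ∑ q ∈ H, c = ∑ q ∈ H, nextPt d S q := by
      rw [← Finset.sum_add_distrib]
      exact Finset.sum_congr rfl fun q hq => by
        have := hc q hq; have := (next_spec hd hSn hlt q).1; omega
    have e2 : ∑ q ∈ H, (q - c) + ∑ q ∈ H, c = ∑ q ∈ H, q := by
      rw [← Finset.sum_add_distrib]
      exact Finset.sum_congr rfl fun q hq => by have := hc q hq; omega
    omega
  -- residues are permuted
  have hinj2 : Set.InjOn (fun q => nextPt d S q % d) (H : Set ℕ) := fun p hp q hq h =>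
    hinj hp hq (next_mod_inj hd hSn hlt (hmem p hp) (hmem q hq) h)
  have himg : H.image (fun q => nextPt d S q % d) = S := by
    apply Finset.eq_of_subset_of_card_le
    · intro y hy
      obtain ⟨q, _, rfl⟩ := Finset.mem_image.1 hy
      exact (next_spec hd hSn hlt q).2
    · rw [Finset.card_image_of_injOn hinj2, hS]
      exact Finset.card_image_le
  let f : ℕ → ℕ := fun s => (s + d * (c + 1) - c) % d
  have hf : ∀ q, c ≤ q → (q - c) % d = f (q % d) := by
    intro q hq
    have hcd : c ≤ d * (c + 1) := by nlinarith
    have h1 : q % d + d * (c + 1) - c + d * (q / d) = (q - c) + d * (c + 1) := by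
      have := Nat.mod_add_div q d
      omega
    have h2 := congrArg (· % d) h1
    simp only [Nat.add_mul_mod_self_left] at h2
    exact h2.symm
  have hres : ∑ q ∈ H, (nextPt d S q - c) % d = ∑ q ∈ H, (q - c) % d := by
    have e1 : ∑ q ∈ H, (nextPt d S q - c) % d = ∑ s ∈ S, f s := by
      conv_rhs => rw [← himg]
      rw [Finset.sum_image hinj2]
      exact Finset.sum_congr rfl fun q hq => hf _ (by
        have := hc q hq; have := (next_spec hd hSn hlt q).1; omega)
    have e2 : ∑ q ∈ H, (q - c) % d = ∑ s ∈ S, f s := by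
      conv_rhs => rw [hS]
      rw [Finset.sum_image hinj]
      exact Finset.sum_congr rfl fun q hq => hf _ (hc q hq)
    rw [e1, e2]
  have g1 : ∀ F : ℕ → ℕ, ∑ q ∈ H, F q = ∑ q ∈ H, F q % d + d * ∑ q ∈ H, F q / d := by
    intro F
    rw [Finset.mul_sum, ← Finset.sum_add_distrib]
    exact Finset.sum_congr rfl fun q _ => (Nat.mod_add_div _ _).symm
  have g2 := g1 (fun q => nextPt d S q - c)
  have g3 := g1 (fun q => q - c)
  rw [htot', hres] at g2
  have : d * ∑ q ∈ H, (nextPt d S q - c) / d = d * (∑ q ∈ H, (q - c) / d + 1) := by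
    rw [mul_add]; omega
  exact Nat.eq_of_mul_eq_mul_left hd this

end nxt
end Spiral

namespace Spiral

section conf
variable {d : ℕ}

lemma pt_mod (x : Fin d → ℕ) (i : Fin d) : (x i * d + i.val) % d = i.val := by
  rw [add_comm, Nat.add_mul_mod_self_right, Nat.mod_eq_of_lt i.2]

lemma pt_div (x : Fin d → ℕ) (i : Fin d) : (x i * d + i.val) / d = x i := by
  have : 0 < d := i.pos
  rw [add_comm, Nat.add_mul_div_right _ _ this, Nat.div_eq_of_lt i.2, zero_add]

lemma pt_inj (x : Fin d → ℕ) : Function.Injective (fun i : Fin d => x i * d + i.val) := by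
  intro i j h
  have := congrArg (· % d) h
  simp only [pt_mod] at this
  exact Fin.ext this

lemma pts_card (x : Fin d → ℕ) : (pts d x).card = d := by
  rw [pts, Finset.card_image_of_injective _ (pt_inj x)]; simp

lemma pts_injOn (x : Fin d → ℕ) : Set.InjOn (· % d) (pts d x : Set ℕ) := by
  intro p hp q hq h
  obtain ⟨i, _, rfl⟩ := Finset.mem_image.1 (Finset.mem_coe.1 hp)
  obtain ⟨j, _, rfl⟩ := Finset.mem_image.1 (Finset.mem_coe.1 hq)
  simp only [pt_mod] at h
  rw [Fin.ext h]

lemma pts_inj {x y : Fin d → ℕ} (h : pts d x = pts d y) : x = y := by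
  funext i
  have : x i * d + i.val ∈ pts d y := h ▸ Finset.mem_image_of_mem _ (Finset.mem_univ i)
  obtain ⟨j, _, hj⟩ := Finset.mem_image.1 this
  have h1 := congrArg (· % d) hj
  simp only [pt_mod] at h1
  obtain rfl := Fin.ext h1
  have h2 := congrArg (· / d) hj
  simp only [pt_div] at h2
  exact h2.symm

lemma pts_read (hd : 1 ≤ d) {Q : Finset ℕ} (hinj : Set.InjOn (· % d) (Q : Set ℕ))
    (hcard : Q.card = d) :
    pts d (fun i : Fin d => ∑ q ∈ Q.filter (fun q => q % d = i.val), q / d) = Q := by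
  symm
  apply Finset.eq_of_subset_of_card_le
  · intro q hq
    refine Finset.mem_image.2 ⟨⟨q % d, Nat.mod_lt _ hd⟩, Finset.mem_univ _, ?_⟩
    have : Q.filter (fun q' => q' % d = q % d) = {q} := by
      ext p
      simp only [Finset.mem_filter, Finset.mem_singleton]
      constructor
      · rintro ⟨h1, h2⟩; exact hinj h1 hq h2
      · rintro rfl; exact ⟨hq, rfl⟩
    simp only [this, Finset.sum_singleton]
    rw [mul_comm, Nat.div_add_mod]
  · rw [pts_card, hcard]

lemma size_eq (x : Fin d → ℕ) : size x = ∑ q ∈ pts d x, q / d := by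
  rw [pts, Finset.sum_image (fun i _ j _ h => pt_inj x h)]
  simp only [pt_div, size]

lemma pt_sub_lt (x : Fin d → ℕ) {i j : Fin d} (h : i < j) :
    ((x j * d + j.val) - (x i * d + i.val)) / d = x j - x i := by
  have hi := i.2
  have hj := j.2
  have h' : i.val < j.val := h
  rcases le_or_gt (x i) (x j) with hx | hx
  · obtain ⟨k, hk⟩ := Nat.exists_eq_add_of_le hx
    rw [hk, Nat.div_eq_iff (by omega), add_mul, Nat.add_sub_cancel_left]
    constructor <;> omega
  · have : x j * d + d ≤ x i * d := by nlinarith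
    rw [Nat.sub_eq_zero_of_le (by omega), Nat.sub_eq_zero_of_le hx.le, Nat.zero_div]

lemma pt_sub_gt (x : Fin d → ℕ) {i j : Fin d} (h : i < j) :
    ((x i * d + i.val) - (x j * d + j.val)) / d = x i - x j - 1 := by
  have hi := i.2
  have hj := j.2
  have h' : i.val < j.val := h
  rcases le_or_gt (x i) (x j) with hx | hx
  · have : x i * d ≤ x j * d := by nlinarith
    rw [Nat.sub_eq_zero_of_le (by omega), Nat.sub_eq_zero_of_le hx, Nat.zero_div]
  · obtain ⟨k, hk⟩ := Nat.exists_eq_add_of_lt hx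
    have e : x i - x j - 1 = k := by omega
    rw [e, hk, Nat.div_eq_iff (by omega), add_mul, add_mul]
    constructor <;> omega

lemma weight_eq (x : Fin d → ℕ) :
    weight x = ∑ p ∈ pts d x, ∑ q ∈ pts d x, (q - p) / d := by
  rw [pts, Finset.sum_image (fun i _ j _ h => pt_inj x h)]
  simp_rw [Finset.sum_image (fun (i : Fin d) (_ : i ∈ (Finset.univ : Finset (Fin d))) j
    (_ : j ∈ (Finset.univ : Finset (Fin d))) h => pt_inj x h)]
  have e : ∀ i j : Fin d, ((x j * d + j.val) - (x i * d + i.val)) / d =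
      (if i < j then x j - x i else 0) + (if j < i then x j - x i - 1 else 0) := by
    intro i j
    rcases lt_trichotomy i j with h | h | h
    · rw [pt_sub_lt x h, if_pos h, if_neg h.asymm, add_zero]
    · subst h; simp
    · rw [pt_sub_gt x h, if_pos h, if_neg h.asymm, zero_add]
  simp_rw [e, Finset.sum_add_distrib]
  rw [Finset.sum_comm (f := fun i j : Fin d => if j < i then x j - x i - 1 else 0)]
  simp_rw [← Finset.sum_add_distrib]
  unfold weight
  refine Finset.sum_congr rfl fun i _ => Finset.sum_congr rfl fun j _ => ?_
  split_ifs <;> rfl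

lemma sorted_lt (x : Fin d → ℕ) : (sortedPts d x).Pairwise (· < ·) :=
  (Finset.sortedLT_sort _).pairwise

lemma sorted_len (x : Fin d → ℕ) : (sortedPts d x).length = d := by
  rw [sortedPts, Finset.length_sort, pts_card]

/-- Lowest `j` points. -/
def lowF (d j : ℕ) (x : Fin d → ℕ) : Finset ℕ := ((sortedPts d x).take j).toFinset
/-- The other points. -/
def highF (d j : ℕ) (x : Fin d → ℕ) : Finset ℕ := ((sortedPts d x).drop j).toFinset
/-- Seats of the other points. -/
def seats (d j : ℕ) (x : Fin d → ℕ) : Finset ℕ := (highF d j x).image (· % d)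

lemma low_union_high (j : ℕ) (x : Fin d → ℕ) : lowF d j x ∪ highF d j x = pts d x := by
  rw [lowF, highF, ← List.toFinset_append, List.take_append_drop, sortedPts, Finset.sort_toFinset]

lemma low_lt_high {j : ℕ} {x : Fin d → ℕ} {p q : ℕ} (hp : p ∈ lowF d j x) (hq : q ∈ highF d j x) :
    p < q := by
  have h := sorted_lt x
  rw [← List.take_append_drop j (sortedPts d x), List.pairwise_append] at h
  exact h.2.2 p (by simpa [lowF] using hp) q (by simpa [highF] using hq)

lemma low_disj_high (j : ℕ) (x : Fin d → ℕ) : Disjoint (lowF d j x) (highF d j x) :=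
  Finset.disjoint_left.2 fun _ h1 h2 => lt_irrefl _ (low_lt_high h1 h2)

lemma low_card {j : ℕ} (hj : j < d) (x : Fin d → ℕ) : (lowF d j x).card = j := by
  rw [lowF, List.toFinset_card_of_nodup, List.length_take, sorted_len]
  · omega
  · exact ((sorted_lt x).imp (fun h => ne_of_lt h)).sublist (List.take_sublist _ _)

lemma high_card {j : ℕ} (hj : j < d) (x : Fin d → ℕ) : (highF d j x).card = d - j := by
  rw [highF, List.toFinset_card_of_nodup, List.length_drop, sorted_len]
  exact ((sorted_lt x).imp (fun h => ne_of_lt h)).sublist (List.drop_sublist _ _)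

lemma high_ne {j : ℕ} (hj : j < d) (x : Fin d → ℕ) : (highF d j x).Nonempty := by
  rw [← Finset.card_pos, high_card hj]; omega

lemma high_sub (j : ℕ) (x : Fin d → ℕ) : highF d j x ⊆ pts d x := by
  rw [← low_union_high j x]; exact Finset.subset_union_right

lemma low_sub (j : ℕ) (x : Fin d → ℕ) : lowF d j x ⊆ pts d x := by
  rw [← low_union_high j x]; exact Finset.subset_union_left

lemma high_injOn (j : ℕ) (x : Fin d → ℕ) : Set.InjOn (· % d) (highF d j x : Set ℕ) :=
  (pts_injOn x).mono (Finset.coe_subset.2 (high_sub j x))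

lemma seats_ne {j : ℕ} (hj : j < d) (x : Fin d → ℕ) : (seats d j x).Nonempty :=
  (high_ne hj x).image _

lemma seats_lt {j : ℕ} (hj : j < d) (x : Fin d → ℕ) : ∀ s ∈ seats d j x, s < d := by
  intro s hs
  obtain ⟨q, _, rfl⟩ := Finset.mem_image.1 hs
  exact Nat.mod_lt _ (by omega)

lemma mem_seats {j : ℕ} {x : Fin d → ℕ} {q : ℕ} (hq : q ∈ highF d j x) : q % d ∈ seats d j x :=
  Finset.mem_image_of_mem _ hq

lemma low_not_seat {j : ℕ} {x : Fin d → ℕ} {p : ℕ} (hp : p ∈ lowF d j x) :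
    p % d ∉ seats d j x := by
  intro h
  obtain ⟨q, hq, h⟩ := Finset.mem_image.1 h
  have := pts_injOn x (low_sub j x hp) (high_sub j x hq) h.symm
  have := low_lt_high hp hq
  omega

/-- The seats of the high points are those missed by the low points. -/
lemma seats_eq {j : ℕ} (hj : j < d) (x : Fin d → ℕ) :
    seats d j x = Finset.range d \ (lowF d j x).image (· % d) := by
  apply Finset.eq_of_subset_of_card_le
  · intro s hs
    rw [Finset.mem_sdiff, Finset.mem_range]
    refine ⟨seats_lt hj x s hs, fun h => ?_⟩
    obtain ⟨p, hp, rfl⟩ := Finset.mem_image.1 h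
    exact low_not_seat hp hs
  · rw [Finset.card_sdiff_of_subset, Finset.card_range, seats,
      Finset.card_image_of_injOn (high_injOn j x), high_card hj,
      Finset.card_image_of_injOn ((pts_injOn x).mono (Finset.coe_subset.2 (low_sub j x))),
      low_card hj]
    intro s hs
    obtain ⟨p, hp, rfl⟩ := Finset.mem_image.1 hs
    exact Finset.mem_range.2 (Nat.mod_lt _ (by omega))

lemma next_high_injOn {j : ℕ} (hj : j < d) (x : Fin d → ℕ) :
    Set.InjOn (nextPt d (seats d j x)) (highF d j x : Set ℕ) := fun _ hp _ hq h =>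
  next_inj (by omega) (seats_ne hj x) (seats_lt hj x) (mem_seats hp) (mem_seats hq) h

lemma low_disj_next {j : ℕ} (hj : j < d) (x : Fin d → ℕ) :
    Disjoint (lowF d j x) ((highF d j x).image (nextPt d (seats d j x))) := by
  rw [Finset.disjoint_left]
  intro p hp h
  obtain ⟨q, hq, rfl⟩ := Finset.mem_image.1 h
  have := low_lt_high hp hq
  have := (next_spec (by omega) (seats_ne hj x) (seats_lt hj x) q).1
  omega

lemma pts_gOp {j : ℕ} (hj : j < d) (x : Fin d → ℕ) :
    pts d (gOp d (j + 1) x) =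
      lowF d j x ∪ (highF d j x).image (nextPt d (seats d j x)) := by
  have hd : 1 ≤ d := by omega
  have e : gOp d (j + 1) x = fun i : Fin d =>
      ∑ q ∈ (lowF d j x ∪ (highF d j x).image (nextPt d (seats d j x))).filter
        (fun q => q % d = i.val), q / d := by
    funext i
    have h1 : (((sortedPts d x).drop j).map (nextPt d (seats d j x))).toFinset =
        (highF d j x).image (nextPt d (seats d j x)) := by
      ext q; simp [highF, -List.map_drop]
    rw [← h1]
    rfl
  rw [e]
  apply pts_read hd
  · intro p hp q hq h
    rw [Finset.mem_coe, Finset.mem_union] at hp hq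
    rcases hp with hp | hp <;> rcases hq with hq | hq
    · exact pts_injOn x (low_sub j x hp) (low_sub j x hq) h
    · exfalso
      obtain ⟨q, hq, rfl⟩ := Finset.mem_image.1 hq
      have := (next_spec hd (seats_ne hj x) (seats_lt hj x) q).2
      simp only at h
      rw [← h] at this
      exact low_not_seat hp this
    · exfalso
      obtain ⟨p, hp, rfl⟩ := Finset.mem_image.1 hp
      have := (next_spec hd (seats_ne hj x) (seats_lt hj x) p).2
      simp only at h
      rw [h] at this
      exact low_not_seat hq this
    · obtain ⟨q', hq', rfl⟩ := Finset.mem_image.1 hq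
      obtain ⟨p', hp', rfl⟩ := Finset.mem_image.1 hp
      rw [high_injOn j x hp' hq'
        (next_mod_inj hd (seats_ne hj x) (seats_lt hj x) (mem_seats hp') (mem_seats hq') h)]
  · rw [Finset.card_union_of_disjoint (low_disj_next hj x), low_card hj,
      Finset.card_image_of_injOn (next_high_injOn hj x), high_card hj]
    omega

lemma sorted_gOp {j : ℕ} (hj : j < d) (x : Fin d → ℕ) :
    sortedPts d (gOp d (j + 1) x) = (sortedPts d x).take j ++
      ((sortedPts d x).drop j).map (nextPt d (seats d j x)) := by
  have hd : 1 ≤ d := by omega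
  have hlt : ((sortedPts d x).take j ++
      ((sortedPts d x).drop j).map (nextPt d (seats d j x))).Pairwise (· < ·) := by
    rw [List.pairwise_append]
    refine ⟨(sorted_lt x).sublist (List.take_sublist _ _), ?_, ?_⟩
    · rw [List.pairwise_map]
      have h := (sorted_lt x).sublist (List.drop_sublist j _)
      refine h.imp_of_mem ?_
      intro p q _ hq h
      exact next_mono hd (seats_ne hj x) (seats_lt hj x) h
        (mem_seats (by simpa [highF] using hq))
    · intro p hp q hq
      obtain ⟨q', hq', rfl⟩ := List.mem_map.1 hq
      have h1 : p < q' := low_lt_high (j := j) (x := x) (by simpa [lowF] using hp)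
        (by simpa [highF] using hq')
      exact h1.trans (next_spec hd (seats_ne hj x) (seats_lt hj x) q').1
  rw [sortedPts, pts_gOp hj]
  have h1 : lowF d j x ∪ (highF d j x).image (nextPt d (seats d j x)) =
      ((sortedPts d x).take j ++
      ((sortedPts d x).drop j).map (nextPt d (seats d j x))).toFinset := by
    ext q; simp [highF, lowF, -List.map_drop]
  rw [h1]
  exact (List.toFinset_sort (· ≤ ·) (hlt.imp (fun h => ne_of_lt h))).2
    (hlt.imp (fun h => le_of_lt h))

lemma size_gOp {j : ℕ} (hj : j < d) (x : Fin d → ℕ) :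
    size (gOp d (j + 1) x) = size x + 1 := by
  rw [size_eq, size_eq, pts_gOp hj, Finset.sum_union (low_disj_next hj x),
    Finset.sum_image (next_high_injOn hj x), ← low_union_high j x,
    Finset.sum_union (low_disj_high j x)]
  have := shift_sum (by omega) (high_ne hj x) (high_injOn j x) (rfl : seats d j x = _) 0
    (fun q _ => Nat.zero_le _)
  simp only [Nat.sub_zero] at this
  rw [this]
  ring

lemma weight_gOp {j : ℕ} (hj : j < d) (x : Fin d → ℕ) :
    weight (gOp d (j + 1) x) = weight x + j := by
  have hd : 1 ≤ d := by omega
  rw [weight_eq, weight_eq, pts_gOp hj, ← low_union_high j x]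
  simp_rw [Finset.sum_union (low_disj_next hj x), Finset.sum_union (low_disj_high j x),
    Finset.sum_image (next_high_injOn hj x)]
  simp_rw [Finset.sum_add_distrib]
  have h1 : ∑ p ∈ lowF d j x, ∑ q ∈ highF d j x, (nextPt d (seats d j x) q - p) / d =
      ∑ p ∈ lowF d j x, ∑ q ∈ highF d j x, (q - p) / d + j := by
    have : ∀ p ∈ lowF d j x, ∑ q ∈ highF d j x, (nextPt d (seats d j x) q - p) / d =
        ∑ q ∈ highF d j x, (q - p) / d + 1 := fun p hp =>
      shift_sum hd (high_ne hj x) (high_injOn j x) rfl p (fun q hq => (low_lt_high hp hq).le)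
    rw [Finset.sum_congr rfl this, Finset.sum_add_distrib, Finset.sum_const, low_card hj,
      smul_eq_mul, mul_one]
  have h2 : ∑ p ∈ highF d j x, ∑ q ∈ lowF d j x, (q - nextPt d (seats d j x) p) / d =
      ∑ p ∈ highF d j x, ∑ q ∈ lowF d j x, (q - p) / d := by
    refine Finset.sum_congr rfl fun p hp => Finset.sum_congr rfl fun q hq => ?_
    have a1 := low_lt_high hq hp
    have a2 := (next_spec hd (seats_ne hj x) (seats_lt hj x) p).1
    rw [Nat.sub_eq_zero_of_le (by omega), Nat.sub_eq_zero_of_le (by omega)]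
  have h3 : ∑ p ∈ highF d j x, ∑ q ∈ highF d j x,
        (nextPt d (seats d j x) q - nextPt d (seats d j x) p) / d =
      ∑ p ∈ highF d j x, ∑ q ∈ highF d j x, (q - p) / d :=
    Finset.sum_congr rfl fun p hp => Finset.sum_congr rfl fun q hq =>
      next_div hd (seats_ne hj x) (seats_lt hj x) (mem_seats hp) (mem_seats hq)
  rw [h1, h2, h3]
  ring

lemma low_gOp {j : ℕ} (hj : j < d) (x : Fin d → ℕ) : lowF d j (gOp d (j + 1) x) = lowF d j x := by
  have : ((sortedPts d x).take j).length = j := by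
    rw [List.length_take, sorted_len]; omega
  rw [lowF, sorted_gOp hj, List.take_left' this, lowF]

lemma gOp_inj {j : ℕ} (hj : j < d) : Function.Injective (gOp d (j + 1)) := by
  intro x y h
  have hd : 1 ≤ d := by omega
  have hl : lowF d j x = lowF d j y := by rw [← low_gOp hj x, h, low_gOp hj y]
  have hs : seats d j x = seats d j y := by rw [seats_eq hj, seats_eq hj, hl]
  have hp : pts d (gOp d (j + 1) x) = pts d (gOp d (j + 1) y) := by rw [h]
  rw [pts_gOp hj, pts_gOp hj] at hp
  have key : ∀ x y : Fin d → ℕ, lowF d j x = lowF d j y → seats d j x = seats d j y →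
      lowF d j x ∪ (highF d j x).image (nextPt d (seats d j x)) =
      lowF d j y ∪ (highF d j y).image (nextPt d (seats d j y)) →
      highF d j x ⊆ highF d j y := by
    intro x y hl hs hp q hq
    have h1 : nextPt d (seats d j x) q ∈
        lowF d j y ∪ (highF d j y).image (nextPt d (seats d j y)) := by
      rw [← hp]
      exact Finset.mem_union_right _ (Finset.mem_image_of_mem _ hq)
    rcases Finset.mem_union.1 h1 with h2 | h2
    · rw [← hl] at h2
      exact absurd (Finset.mem_image_of_mem _ hq) (Finset.disjoint_left.1 (low_disj_next hj x) h2)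
    · obtain ⟨q', hq', h3⟩ := Finset.mem_image.1 h2
      rw [hs] at h3
      have := next_inj hd (seats_ne hj y) (seats_lt hj y) (mem_seats hq')
        (hs ▸ mem_seats hq) h3
      rwa [← this]
  apply pts_inj
  rw [← low_union_high j x, ← low_union_high j y, hl,
    Finset.Subset.antisymm (key x y hl hs hp) (key y x hl.symm hs.symm hp.symm)]

/-- The point number `k` (0-indexed). -/
def del (d k : ℕ) (x : Fin d → ℕ) : ℕ := (sortedPts d x).getD k 0

lemma del_gOp_lt {j k : ℕ} (hj : j < d) (hk : k < j) (x : Fin d → ℕ) :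
    del d k (gOp d (j + 1) x) = del d k x := by
  have h1 : k < ((sortedPts d x).take j).length := by
    rw [List.length_take, sorted_len]; omega
  rw [del, sorted_gOp hj, List.getD_append _ _ _ _ h1, del]
  simp only [List.getD_eq_getElem?_getD]
  rw [List.getElem?_take_of_lt hk]

lemma del_gOp_self {j : ℕ} (hj : j < d) (x : Fin d → ℕ) :
    del d j x < del d j (gOp d (j + 1) x) := by
  have h1 : ((sortedPts d x).take j).length = j := by
    rw [List.length_take, sorted_len]; omega
  have h2 : j < (sortedPts d x).length := by rw [sorted_len]; exact hj
  rw [del, del, sorted_gOp hj, List.getD_append_right _ _ _ _ h1.le, h1, Nat.sub_self]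
  have h3 : 0 < (((sortedPts d x).drop j).map (nextPt d (seats d j x))).length := by
    rw [List.length_map, List.length_drop]; omega
  rw [List.getD_eq_getElem _ _ h2, List.getD_eq_getElem _ _ h3, List.getElem_map,
    List.getElem_drop]
  exact (next_spec (by omega) (seats_ne hj x) (seats_lt hj x) _).1

lemma del_iter_lt {j k : ℕ} (hj : j < d) (hk : k < j) (n : ℕ) (x : Fin d → ℕ) :
    del d k ((gOp d (j + 1))^[n] x) = del d k x := by
  induction n with
  | zero => rfl
  | succ n ih => rw [Function.iterate_succ_apply', del_gOp_lt hj hk, ih]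

lemma del_iter_self {j : ℕ} (hj : j < d) (n : ℕ) (x : Fin d → ℕ) :
    del d j x + n ≤ del d j ((gOp d (j + 1))^[n] x) := by
  induction n with
  | zero => simp
  | succ n ih =>
    rw [Function.iterate_succ_apply']
    have := del_gOp_self hj ((gOp d (j + 1))^[n] x)
    omega

lemma size_iter {j : ℕ} (hj : j < d) (n : ℕ) (x : Fin d → ℕ) :
    size ((gOp d (j + 1))^[n] x) = size x + n := by
  induction n with
  | zero => simp
  | succ n ih => rw [Function.iterate_succ_apply', size_gOp hj, ih]; ring

lemma weight_iter {j : ℕ} (hj : j < d) (n : ℕ) (x : Fin d → ℕ) :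
    weight ((gOp d (j + 1))^[n] x) = weight x + j * n := by
  induction n with
  | zero => simp
  | succ n ih => rw [Function.iterate_succ_apply', weight_gOp hj, ih]; ring

/-- Partial composition. -/
noncomputable def gL (l : List (Fin d)) (a : Fin d → ℕ) (x : Fin d → ℕ) : Fin d → ℕ :=
  l.foldr (fun j y => (gOp d (j.val + 1))^[a j] y) x

lemma gL_cons (j : Fin d) (l : List (Fin d)) (a x : Fin d → ℕ) :
    gL (j :: l) a x = (gOp d (j.val + 1))^[a j] (gL l a x) := rfl

lemma size_gL (l : List (Fin d)) (a x : Fin d → ℕ) :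
    size (gL l a x) = size x + (l.map a).sum := by
  induction l with
  | nil => simp [gL]
  | cons j l ih => rw [gL_cons, size_iter j.2, ih, List.map_cons, List.sum_cons]; ring

lemma weight_gL (l : List (Fin d)) (a x : Fin d → ℕ) :
    weight (gL l a x) = weight x + (l.map (fun i => i.val * a i)).sum := by
  induction l with
  | nil => simp [gL]
  | cons j l ih => rw [gL_cons, weight_iter j.2, ih, List.map_cons, List.sum_cons]; ring

lemma del_gL (l : List (Fin d)) (a x : Fin d → ℕ) (k : ℕ) (hk : ∀ j ∈ l, k < j.val) :
    del d k (gL l a x) = del d k x := by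
  induction l with
  | nil => rfl
  | cons j l ih =>
    rw [gL_cons, del_iter_lt j.2 (hk j (by simp)), ih (fun i hi => hk i (by simp [hi]))]

lemma gL_inj (l : List (Fin d)) (hl : l.Pairwise (· < ·)) (x : Fin d → ℕ) (a b : Fin d → ℕ)
    (h : gL l a x = gL l b x) : ∀ i ∈ l, a i = b i := by
  induction l with
  | nil => simp
  | cons j l ih =>
    rw [List.pairwise_cons] at hl
    have key : ∀ a b : Fin d → ℕ, a j ≤ b j → gL (j :: l) a x = gL (j :: l) b x →
        a j = b j ∧ gL l a x = gL l b x := by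
      intro a b hab h
      obtain ⟨c, hc⟩ := Nat.exists_eq_add_of_le hab
      rw [gL_cons, gL_cons, hc, Function.iterate_add_apply] at h
      have h1 := (gOp_inj j.2).iterate _ h
      have h2 := del_iter_self j.2 c (gL l b x)
      rw [← h1, del_gL _ _ _ _ hl.1, del_gL _ _ _ _ hl.1] at h2
      obtain rfl : c = 0 := by omega
      exact ⟨by omega, h1⟩
    have : a j = b j ∧ gL l a x = gL l b x := by
      rcases le_total (a j) (b j) with hab | hab
      · exact key a b hab h
      · exact ⟨(key b a hab h.symm).1.symm, (key b a hab h.symm).2.symm⟩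
    intro i hi
    rcases List.mem_cons.1 hi with rfl | hi
    · exact this.1
    · exact ih hl.2 this.2 i hi

lemma gIter_inj (x : Fin d → ℕ) : Function.Injective (fun a => gIter d a x) := by
  intro a b h
  funext i
  exact gL_inj (List.finRange d) (List.pairwise_lt_finRange d) x a b h i (List.mem_finRange i)

lemma size_gIter (a x : Fin d → ℕ) : size (gIter d a x) = size x + ∑ i, a i := by
  rw [← List.sum_ofFn, List.ofFn_eq_map]
  exact size_gL _ _ _

lemma weight_gIter (a x : Fin d → ℕ) :
    weight (gIter d a x) = weight x + ∑ i : Fin d, i.val * a i := by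
  rw [← List.sum_ofFn, List.ofFn_eq_map]
  exact weight_gL _ _ _

end conf

/-- Exponent of `t^A q^B`. -/
noncomputable def ex (A B : ℕ) : Fin 2 →₀ ℕ := Finsupp.single 0 A + Finsupp.single 1 B

lemma ex_zero (A B : ℕ) : ex A B 0 = A := by simp [ex]
lemma ex_one (A B : ℕ) : ex A B 1 = B := by simp [ex]

lemma monomial_ex (A B : ℕ) : (MvPowerSeries.X 0 ^ A * MvPowerSeries.X 1 ^ B :
    MvPowerSeries (Fin 2) ℤ) = MvPowerSeries.monomial (ex A B) 1 := by
  rw [MvPowerSeries.X_pow_eq, MvPowerSeries.X_pow_eq, MvPowerSeries.monomial_mul_monomial, one_mul,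
    ex]

end Spiral

open Spiral in
/-- Let `x₀ ∈ ℕ^d` and let `Γ′` be the subsemigroup of `(ℕ^d, +)` freely
generated by `a⁽¹⁾,…,a⁽ʳ⁾` (every element of `Γ′` is uniquely `k₁a⁽¹⁾ + ⋯ + k_r a⁽ʳ⁾`,
`k_i ∈ ℕ`; freeness is the injectivity hypothesis `hfree`). Then in `ℤ[[t,q]]`,
`Σ_{x ∈ Γ′·x₀} t^{n(x)} q^{W(x)} = t^{n(x₀)} q^{W(x₀)} · ∏_{i=1}^r (1 − Cont(a⁽ⁱ⁾))⁻¹`,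
stated multiplicatively (each `1 − Cont(a⁽ⁱ⁾)` is a unit):
`(∏ᵢ (1 − Cont(a⁽ⁱ⁾))) · Σ_{x ∈ Γ′·x₀} t^{n(x)} q^{W(x)} = t^{n(x₀)} q^{W(x₀)}`. -/
theorem statement11 (d : ℕ) (hd : 1 ≤ d) (x₀ : Fin d → ℕ) (r : ℕ)
    (a : Fin r → Fin d → ℕ)
    (hfree : Function.Injective fun k : Fin r → ℕ => ∑ i, k i • a i) :
    (∏ i : Fin r, (1 - contGamma d (a i))) *
      orbitSeries d {x | ∃ k : Fin r → ℕ, gIter d (∑ i, k i • a i) x₀ = x} =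
      MvPowerSeries.X 0 ^ size x₀ * MvPowerSeries.X 1 ^ weight x₀ := by

  classical
  set u : Fin r → (Fin 2 →₀ ℕ) := fun i => ex (∑ l, a i l) (∑ l : Fin d, l.val * a i l) with hu
  have hne : ∀ i, u i 0 ≠ 0 := by
    intro i h0
    rw [hu] at h0
    simp only [ex_zero] at h0
    have hz : a i = 0 := by
      funext l
      exact (Finset.sum_eq_zero_iff.1 h0) l (Finset.mem_univ l)
    have h1 : (∑ l, (Pi.single i 1 : Fin r → ℕ) l • a l) = ∑ l, (0 : Fin r → ℕ) l • a l := by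
      simp [Pi.single_apply, hz]
    have h2 := congrFun (hfree h1) i
    simp at h2
  have hprod := gf_prod (ex (size x₀) (weight x₀)) u hne
  have hser : orbitSeries d {x | ∃ k : Fin r → ℕ, gIter d (∑ i, k i • a i) x₀ = x} =
      gf (ex (size x₀) (weight x₀)) u := by
    have hinj : Function.Injective (fun k : Fin r → ℕ => gIter d (∑ i, k i • a i) x₀) :=
      (gIter_inj x₀).comp hfree
    have hs : ∀ k : Fin r → ℕ, size (gIter d (∑ i, k i • a i) x₀) =
        (ex (size x₀) (weight x₀) + ∑ i, k i • u i) 0 := by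
      intro k
      rw [size_gIter]
      simp only [hu, Finsupp.add_apply, Finsupp.finsetSum_apply, Finsupp.smul_apply, ex_zero,
        Finset.sum_apply, Pi.smul_apply, smul_eq_mul, Finset.mul_sum]
      rw [Finset.sum_comm]
    have hw : ∀ k : Fin r → ℕ, weight (gIter d (∑ i, k i • a i) x₀) =
        (ex (size x₀) (weight x₀) + ∑ i, k i • u i) 1 := by
      intro k
      rw [weight_gIter]
      simp only [hu, Finsupp.add_apply, Finsupp.finsetSum_apply, Finsupp.smul_apply, ex_one,
        Finset.sum_apply, Pi.smul_apply, smul_eq_mul, Finset.mul_sum]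
      rw [Finset.sum_comm]
      congr 1
      refine Finset.sum_congr rfl fun _ _ => Finset.sum_congr rfl fun _ _ => ?_
      ring
    funext e
    unfold orbitSeries gf
    congr 1
    symm
    refine Nat.card_congr (Equiv.ofBijective
      (fun k => ⟨gIter d (∑ i, k.1 i • a i) x₀, ⟨k.1, rfl⟩, ?_, ?_⟩) ⟨?_, ?_⟩)
    · rw [hs, k.2]
    · rw [hw, k.2]
    · intro k k' h
      exact Subtype.ext (hinj (congrArg Subtype.val h))
    · rintro ⟨x, ⟨k, rfl⟩, h1, h2⟩
      refine ⟨⟨k, ?_⟩, rfl⟩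
      ext s
      fin_cases s
      · exact (hs k).symm.trans h1
      · exact (hw k).symm.trans h2
  rw [hser, monomial_ex, ← hprod]
  congr 1
  refine Finset.prod_congr rfl fun i _ => ?_
  rw [contGamma, monomial_ex]
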